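/- Let s : ℝ → ℝ be a C³ function, define φ : ℝ² → ℝ by φ(z) = s(z₁), and define Φ, Ψ : ℝ² → ℝ² by Φ(z) = (φ(z)z₁ + z₂²·∂₁φ(z), φ(z)z₂ − z₂z₁·∂₁φ(z)) and Ψ(z) = (−∂₁φ(z), (z₂/2)·∂₁∂₁φ(z)). Then for every C² divergence-free vector field m = (m₁, m₂) on an open set U ⊂ ℝ² (i.e. ∂₁m₁ + ∂₂m₂ ≡ 0 on U), the pointwise identity div[Φ(m)] = Ψ(m)·∇(1 − |m|²) holds on U. -/

import Mathlib

open MeasureTheory Metric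
open scoped RealInnerProductSpace ENNReal

noncomputable section

abbrev E2 := EuclideanSpace ℝ (Fin 2)

/-- The vector `(a, b) ∈ ℝ²`. -/
def v2 (a b : ℝ) : E2 := (EuclideanSpace.equiv (Fin 2) ℝ).symm ![a, b]

/-- Divergence of a planar vector field. -/
def divg (F : E2 → E2) (x : E2) : ℝ :=
  ∑ j : Fin 2, fderiv ℝ F x (EuclideanSpace.single j 1) j

/-- With `φ(z) = s(z₁)`, the map
`Φ(z) = (φ(z)z₁ + z₂²∂₁φ(z), φ(z)z₂ − z₂z₁∂₁φ(z))`. -/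
def PhiMap (s : ℝ → ℝ) (z : E2) : E2 :=
  v2 (s (z 0) * z 0 + (z 1) ^ 2 * deriv s (z 0))
     (s (z 0) * z 1 - z 1 * z 0 * deriv s (z 0))

/-- With `φ(z) = s(z₁)`, the map `Ψ(z) = (−∂₁φ(z), (z₂/2)∂₁∂₁φ(z))`. -/
def PsiMap (s : ℝ → ℝ) (z : E2) : E2 :=
  v2 (-(deriv s (z 0))) (z 1 / 2 * deriv (deriv s) (z 0))

@[simp] lemma v2_apply_zero (a b : ℝ) : v2 a b 0 = a := rfl

@[simp] lemma v2_apply_one (a b : ℝ) : v2 a b 1 = b := rfl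

lemma hasFDerivAt_coord {F : E2 → E2} {F' : E2 →L[ℝ] E2} {x : E2}
    (hF : HasFDerivAt F F' x) (j : Fin 2) :
    HasFDerivAt (fun y => F y j) ((EuclideanSpace.proj j : E2 →L[ℝ] ℝ).comp F') x :=
  (EuclideanSpace.proj j : E2 →L[ℝ] ℝ).hasFDerivAt.comp x hF

/-- The divergence of `(f, g)` is `∂₁f + ∂₂g`. -/
lemma divg_v2 {f g : E2 → ℝ} {f' g' : E2 →L[ℝ] ℝ} {x : E2}
    (hf : HasFDerivAt f f' x) (hg : HasFDerivAt g g' x) :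
    divg (fun y => v2 (f y) (g y)) x =
      f' (EuclideanSpace.single 0 1) + g' (EuclideanSpace.single 1 1) := by
  have hd : DifferentiableAt ℝ (fun y => v2 (f y) (g y)) x := by
    rw [differentiableAt_euclidean]
    intro j
    fin_cases j
    exacts [hf.differentiableAt, hg.differentiableAt]
  have h0 := (hasFDerivAt_coord hd.hasFDerivAt 0).unique hf
  have h1 := (hasFDerivAt_coord hd.hasFDerivAt 1).unique hg
  rw [divg, Fin.sum_univ_two, ← h0, ← h1]
  rfl

lemma inner_v2_gradient {f : E2 → ℝ} {f' : E2 →L[ℝ] ℝ} {x : E2}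
    (hf : HasFDerivAt f f' x) (a b : ℝ) :
    ⟪v2 a b, gradient f x⟫ =
      a * f' (EuclideanSpace.single 0 1) + b * f' (EuclideanSpace.single 1 1) := by
  have hv : v2 a b = a • EuclideanSpace.single 0 1 + b • EuclideanSpace.single 1 1 := by
    ext j
    fin_cases j <;> simp
  rw [real_inner_comm, gradient, InnerProductSpace.toDual_symm_apply, hf.fderiv, hv,
    map_add, map_smul, map_smul, smul_eq_mul, smul_eq_mul]

/-- identity (9) of the paper: for every `C²` divergence-free field `m` on an
open set `U`, `div[Φ(m)] = Ψ(m) · ∇(1 − |m|²)` pointwise on `U`. -/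
theorem statement19 (s : ℝ → ℝ) (hs : ContDiff ℝ 3 s)
    (U : Set E2) (hU : IsOpen U) (m : E2 → E2) (hm : ContDiffOn ℝ 2 m U)
    (hdiv : ∀ x ∈ U, divg m x = 0) :
    ∀ x ∈ U, divg (fun y => PhiMap s (m y)) x =
      ⟪PsiMap s (m x), gradient (fun y => 1 - ‖m y‖ ^ 2) x⟫ := by
  intro x hx
  have hmx := ((hm.contDiffAt (hU.mem_nhds hx)).differentiableAt (by norm_num)).hasFDerivAt
  have ha := hasFDerivAt_coord hmx 0
  have hb := hasFDerivAt_coord hmx 1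
  have hs' : ContDiff ℝ 1 (deriv s) :=
    (hs.of_le (by norm_num : (1 + 1 : WithTop ℕ∞) ≤ 3)).deriv'
  have hsa := (hs.differentiable (by norm_num) (m x 0)).hasDerivAt.comp_hasFDerivAt x ha
  have hs'a := (hs'.differentiable (by norm_num) (m x 0)).hasDerivAt.comp_hasFDerivAt x ha
  have hdivx := hdiv x hx
  rw [divg, Fin.sum_univ_two] at hdivx
  have hnorm : (fun y => 1 - ‖m y‖ ^ 2) = fun y => 1 - (m y 0 ^ 2 + m y 1 ^ 2) := by
    funext y
    simp [EuclideanSpace.norm_sq_eq, Fin.sum_univ_two]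
  have hN : HasFDerivAt (fun y => 1 - (m y 0 ^ 2 + m y 1 ^ 2)) _ x :=
    ((ha.pow 2).add (hb.pow 2)).const_sub 1
  have hdΦ := divg_v2 ((hsa.mul ha).add ((hb.pow 2).mul hs'a))
    ((hsa.mul hb).sub ((hb.mul ha).mul hs'a))
  rw [hnorm, PsiMap, inner_v2_gradient hN]
  refine hdΦ.trans ?_
  simp
  linear_combination (s (m x 0) - m x 0 * deriv s (m x 0) +
      m x 1 ^ 2 * deriv (deriv s) (m x 0)) * hdivx
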